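/- Let h(x) = -log x - log(1-x) on 𝕋 and let α be irrational with convergent denominators (q_n). Then for every integer r ≥ 1, every n ∈ ℕ, and every x ∈ 𝕋 whose q_n-orbit under the rotation by α does not contain 0: |S_{q_n}(h^{(r)})(x) − (r−1)!·[(−1)^r·(1/x⁻_{n,min})^r + (1/x⁺_{n,min})^r]| < 100·(r−1)!·‖q_{n−1}α‖^{−r}. -/

import Mathlib

open MeasureTheory Filter Topology

noncomputable section

/-- Iterates of the Gauss map applied to the fractional part of `α`. -/
def gaussIter (α : ℝ) (n : ℕ) : ℝ := (fun x : ℝ => Int.fract x⁻¹)^[n] (Int.fract α)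

/-- The `n`-th partial quotient `a_n` of the continued fraction expansion of `α`
(for `n ≥ 1`). -/
def cfA (α : ℝ) (n : ℕ) : ℕ := ⌊(gaussIter α (n - 1))⁻¹⌋₊

/-- The denominators `q_n` of the convergents of the continued fraction of `α`:
`q₀ = 1`, `q₁ = a₁`, `q_{n+1} = a_{n+1} q_n + q_{n-1}`. -/
def cfQ (α : ℝ) : ℕ → ℕ
  | 0 => 1
  | 1 => cfA α 1
  | n + 2 => cfA α (n + 2) * cfQ α (n + 1) + cfQ α n

/-- Birkhoff sums over the rotation by `α`: `S_n(φ)(x) = ∑_{i<n} φ(x + iα)`. -/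
def birkhoffRot (α : ℝ) (φ : ℝ → ℝ) (n : ℕ) (x : ℝ) : ℝ :=
  ∑ i ∈ Finset.range n, φ (x + i * α)

/-- Distance to the nearest integer, `‖x‖ = min(x mod 1, 1 - x mod 1)`. -/
def distNearestInt (x : ℝ) : ℝ := min (Int.fract x) (1 - Int.fract x)

/-- `x⁻_{n,min}`: the minimum of `x + jα (mod 1)` over `0 ≤ j < q`. -/
def orbMinus (α x : ℝ) (q : ℕ) : ℝ :=
  sInf ((fun j : ℕ => Int.fract (x + j * α)) '' Set.Iio q)

/-- `x⁺_{n,min}`: the minimum of `1 - (x + jα (mod 1))` over `0 ≤ j < q`. -/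
def orbPlus (α x : ℝ) (q : ℕ) : ℝ :=
  sInf ((fun j : ℕ => 1 - Int.fract (x + j * α)) '' Set.Iio q)

/-- The `r`-th derivative of `h(x) = -log x - log(1-x)`, read on the circle:
`h^{(r)}(x) = (-1)^r (r-1)! x^{-r} + (r-1)! (1-x)^{-r}`. -/
def symLogDeriv (r : ℕ) (x : ℝ) : ℝ :=
  (-1) ^ r * (Nat.factorial (r - 1)) / (Int.fract x) ^ r
    + (Nat.factorial (r - 1)) / (1 - Int.fract x) ^ r

/-- The numerators `p_n` of the convergents of `α`, with `p₀ = ⌊α⌋`. -/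
def cfP (α : ℝ) : ℕ → ℤ
  | 0 => ⌊α⌋
  | 1 => cfA α 1 * ⌊α⌋ + 1
  | n + 2 => cfA α (n + 2) * cfP α (n + 1) + cfP α n

theorem gaussIter_succ (α : ℝ) (n : ℕ) :
    gaussIter α (n + 1) = Int.fract (gaussIter α n)⁻¹ := by
  simp only [gaussIter, Function.iterate_succ_apply']

theorem irrational_fract {x : ℝ} (hx : Irrational x) : Irrational (Int.fract x) := by
  rw [← Int.self_sub_floor]
  exact hx.sub_intCast _

theorem irrational_gaussIter {α : ℝ} (hα : Irrational α) (n : ℕ) :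
    Irrational (gaussIter α n) := by
  induction n with
  | zero => exact irrational_fract hα
  | succ n ih =>
    rw [gaussIter_succ]
    exact irrational_fract ih.inv

theorem gaussIter_nonneg (α : ℝ) (n : ℕ) : 0 ≤ gaussIter α n := by
  cases n with
  | zero => exact Int.fract_nonneg _
  | succ n => rw [gaussIter_succ]; exact Int.fract_nonneg _

theorem gaussIter_lt_one (α : ℝ) (n : ℕ) : gaussIter α n < 1 := by
  cases n with
  | zero => exact Int.fract_lt_one _
  | succ n => rw [gaussIter_succ]; exact Int.fract_lt_one _

theorem gaussIter_pos {α : ℝ} (hα : Irrational α) (n : ℕ) : 0 < gaussIter α n :=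
  lt_of_le_of_ne (gaussIter_nonneg α n) (irrational_gaussIter hα n).ne_zero.symm

theorem one_le_cfA {α : ℝ} (hα : Irrational α) (n : ℕ) : 1 ≤ cfA α (n + 1) := by
  rw [cfA, Nat.add_sub_cancel, Nat.one_le_floor_iff]
  exact (one_le_inv₀ (gaussIter_pos hα n)).2 (gaussIter_lt_one α n).le

theorem cfA_add_gaussIter {α : ℝ} (hα : Irrational α) (n : ℕ) :
    gaussIter α n * (cfA α (n + 1) + gaussIter α (n + 1)) = 1 := by
  have hg := gaussIter_pos hα n
  rw [cfA, Nat.add_sub_cancel, gaussIter_succ,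
    natCast_floor_eq_intCast_floor (inv_nonneg.2 hg.le), Int.floor_add_fract,
    mul_inv_cancel₀ hg.ne']

theorem cfQ_pos {α : ℝ} (hα : Irrational α) (n : ℕ) : 0 < cfQ α n ∧ 0 < cfQ α (n + 1) := by
  induction n with
  | zero => exact ⟨Nat.one_pos, one_le_cfA hα 0⟩
  | succ n ih =>
    refine ⟨ih.2, ?_⟩
    rw [cfQ]
    exact Nat.add_pos_right _ ih.1

theorem cfQ_le_succ {α : ℝ} (hα : Irrational α) (n : ℕ) : cfQ α n ≤ cfQ α (n + 1) := by
  cases n with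
  | zero => exact one_le_cfA hα 0
  | succ n =>
    rw [cfQ]
    have : 1 * cfQ α (n + 1) ≤ cfA α (n + 2) * cfQ α (n + 1) :=
      Nat.mul_le_mul_right _ (one_le_cfA hα (n + 1))
    omega

theorem cfQ_mul_cfP_sub (α : ℝ) (n : ℕ) :
    (cfQ α (n + 1) : ℤ) * cfP α n - cfQ α n * cfP α (n + 1) = (-1) ^ (n + 1) := by
  induction n with
  | zero => simp [cfQ, cfP]
  | succ n ih =>
    rw [cfQ, cfP, pow_succ, ← ih]
    push_cast
    ring

/-- The approximation errors `q_n α - p_n` are the alternating products of the Gauss iterates. -/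
theorem cfQ_mul_sub_cfP {α : ℝ} (hα : Irrational α) (n : ℕ) :
    (cfQ α n * α - cfP α n = (-1) ^ n * ∏ i ∈ Finset.range (n + 1), gaussIter α i) ∧
    (cfQ α (n + 1) * α - cfP α (n + 1)
      = (-1) ^ (n + 1) * ∏ i ∈ Finset.range (n + 2), gaussIter α i) := by
  induction n with
  | zero =>
    have h := cfA_add_gaussIter hα 0
    have h0 : gaussIter α 0 = α - ⌊α⌋ := (Int.self_sub_floor α).symm
    simp only [cfQ, cfP, Finset.prod_range_succ, Finset.prod_range_zero]
    rw [zero_add] at h ⊢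
    push_cast
    refine ⟨by rw [h0]; ring, ?_⟩
    have : (cfA α 1 : ℝ) * α - (cfA α 1 * ⌊α⌋ + 1) = cfA α 1 * gaussIter α 0 - 1 := by
      rw [h0]; ring
    rw [this]
    linear_combination h
  | succ n ih =>
    refine ⟨ih.2, ?_⟩
    have h := cfA_add_gaussIter hα (n + 1)
    rw [cfQ, cfP]
    push_cast
    have e : ((cfA α (n + 2) : ℝ) * cfQ α (n + 1) + cfQ α n) * α
        - (cfA α (n + 2) * cfP α (n + 1) + cfP α n)
        = cfA α (n + 2) * (cfQ α (n + 1) * α - cfP α (n + 1)) + (cfQ α n * α - cfP α n) := by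
      ring
    rw [e, ih.1, ih.2, Finset.prod_range_succ _ (n + 2), Finset.prod_range_succ _ (n + 1)]
    linear_combination ((-1) ^ (n + 1) * ∏ i ∈ Finset.range (n + 1), gaussIter α i) * h

theorem distNearestInt_le (x : ℝ) (k : ℤ) : distNearestInt x ≤ |x - k| := by
  have hf := Int.floor_add_fract x
  rcases le_or_gt k ⌊x⌋ with h | h
  · have h' : (k : ℝ) ≤ ⌊x⌋ := by exact_mod_cast h
    exact (min_le_left _ _).trans (le_trans (by linarith) (le_abs_self _))
  · have h' : (⌊x⌋ : ℝ) + 1 ≤ k := by exact_mod_cast h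
    exact (min_le_right _ _).trans (le_trans (by linarith) (neg_le_abs _))

theorem distNearestInt_pos {x : ℝ} (hx : Irrational x) : 0 < distNearestInt x :=
  lt_min (lt_of_le_of_ne (Int.fract_nonneg x) (irrational_fract hx).ne_zero.symm)
    (sub_pos.2 (Int.fract_lt_one x))

/-- If `u, v` are positive and `a, b` have weakly opposite signs with `a ≠ 0`,
then `|a u - b v| ≥ u`. -/
theorem le_abs_mul_sub_mul {u v : ℝ} (hu : 0 < u) (hv : 0 < v) {a b : ℤ}
    (h : (1 ≤ a ∧ b ≤ 0) ∨ (a ≤ -1 ∧ 0 ≤ b)) : u ≤ |a * u - b * v| := by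
  rcases h with ⟨ha, hb⟩ | ⟨ha, hb⟩
  · have ha' : (1 : ℝ) ≤ a := by exact_mod_cast ha
    have hb' : (b : ℝ) ≤ 0 := by exact_mod_cast hb
    exact le_trans (by nlinarith) (le_abs_self _)
  · have ha' : (a : ℝ) ≤ -1 := by exact_mod_cast ha
    have hb' : (0 : ℝ) ≤ b := by exact_mod_cast hb
    exact le_trans (by nlinarith) (neg_le_abs _)

/-- Best approximation property of the convergents. -/
theorem distNearestInt_cfQ_le {α : ℝ} (hα : Irrational α) (n j : ℕ) (hj : 0 < j)
    (hjq : j < cfQ α (n + 1)) (k : ℤ) : distNearestInt (cfQ α n * α) ≤ |j * α - k| := by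
  obtain ⟨h0, h1⟩ := cfQ_mul_sub_cfP hα n
  have hdet := cfQ_mul_cfP_sub α n
  have hu : 0 < ∏ i ∈ Finset.range (n + 1), gaussIter α i :=
    Finset.prod_pos fun i _ => gaussIter_pos hα i
  have hv : 0 < ∏ i ∈ Finset.range (n + 2), gaussIter α i :=
    Finset.prod_pos fun i _ => gaussIter_pos hα i
  have hle := distNearestInt_le (cfQ α n * α) (cfP α n)
  rw [h0, abs_mul, abs_neg_one_pow, one_mul, abs_of_pos hu] at hle
  refine hle.trans ?_
  obtain ⟨hq0, hq1⟩ := cfQ_pos hα n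
  generalize (∏ i ∈ Finset.range (n + 1), gaussIter α i) = u at *
  generalize (∏ i ∈ Finset.range (n + 2), gaussIter α i) = v at *
  generalize cfQ α n = q at *
  generalize cfQ α (n + 1) = q' at *
  generalize cfP α n = p at *
  generalize cfP α (n + 1) = p' at *
  obtain ⟨s, hs⟩ : ∃ s : ℤ, s = (-1) ^ n := ⟨_, rfl⟩
  have hsR : (s : ℝ) = (-1) ^ n := by rw [hs]; push_cast; rfl
  have hss : s * s = 1 := by rw [hs, ← mul_pow]; simp
  have hsa : |(s : ℝ)| = 1 := by rw [hsR, abs_neg_one_pow]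
  rw [pow_succ, ← hs] at hdet
  rw [← hsR] at h0
  rw [pow_succ, ← hsR] at h1
  obtain ⟨a, ha⟩ : ∃ a : ℤ, a = s * (j * p' - k * q') := ⟨_, rfl⟩
  obtain ⟨b, hb⟩ : ∃ b : ℤ, b = s * (k * q - j * p) := ⟨_, rfl⟩
  have e1 : a * q + b * q' = j := by
    rw [ha, hb]
    linear_combination (-s * j) * hdet + (j : ℤ) * hss
  have e2 : a * p + b * p' = k := by
    rw [ha, hb]
    linear_combination (-s * k) * hdet + k * hss
  have e1R : (a : ℝ) * q + b * q' = j := by exact_mod_cast e1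
  have e2R : (a : ℝ) * p + b * p' = k := by exact_mod_cast e2
  have key : (j : ℝ) * α - k = s * (a * u - b * v) := by
    rw [← e1R, ← e2R]
    linear_combination (a : ℝ) * h0 + (b : ℝ) * h1
  rw [key, abs_mul, hsa, one_mul]
  apply le_abs_mul_sub_mul hu hv
  have hjZ : (0 : ℤ) < j := by exact_mod_cast hj
  have hjqZ : (j : ℤ) < q' := by exact_mod_cast hjq
  have hqZ : (0 : ℤ) < q := by exact_mod_cast hq0
  rcases lt_trichotomy a 0 with h | h | h
  · right
    refine ⟨by omega, ?_⟩
    by_contra! hb0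
    nlinarith
  · exfalso
    subst h
    rcases le_or_gt b 0 with h | h <;> nlinarith
  · left
    refine ⟨by omega, ?_⟩
    by_contra! hb0
    nlinarith

theorem cfQ_succ_mul_abs_le {α : ℝ} (hα : Irrational α) (n : ℕ) :
    cfQ α (n + 1) * |cfQ α n * α - cfP α n| ≤ 1 := by
  obtain ⟨h0, h1⟩ := cfQ_mul_sub_cfP hα n
  have hdet := cfQ_mul_cfP_sub α n
  have hu : 0 < ∏ i ∈ Finset.range (n + 1), gaussIter α i :=
    Finset.prod_pos fun i _ => gaussIter_pos hα i
  have hv : 0 < ∏ i ∈ Finset.range (n + 2), gaussIter α i :=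
    Finset.prod_pos fun i _ => gaussIter_pos hα i
  have hdetR : (cfQ α (n + 1) : ℝ) * cfP α n - cfQ α n * cfP α (n + 1) = (-1) ^ (n + 1) := by
    exact_mod_cast hdet
  have hs : ((-1 : ℝ) ^ n) * (-1) ^ n = 1 := by rw [← mul_pow]; simp
  rw [h0, abs_mul, abs_neg_one_pow, one_mul, abs_of_pos hu]
  have : (cfQ α (n + 1) : ℝ) * (∏ i ∈ Finset.range (n + 1), gaussIter α i)
      + cfQ α n * (∏ i ∈ Finset.range (n + 2), gaussIter α i) = 1 := by
    rw [pow_succ] at h1 hdetR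
    linear_combination (-(-1 : ℝ) ^ n * cfQ α (n + 1)) * h0 + ((-1 : ℝ) ^ n * cfQ α n) * h1
      - ((-1 : ℝ) ^ n) * hdetR + (1 - cfQ α (n + 1) * (∏ i ∈ Finset.range (n + 1), gaussIter α i)
      - cfQ α n * (∏ i ∈ Finset.range (n + 2), gaussIter α i)) * hs
  have h2 : 0 ≤ (cfQ α n : ℝ) * (∏ i ∈ Finset.range (n + 2), gaussIter α i) := by positivity
  linarith

theorem isCoprime_cfP_cfQ (α : ℝ) (n : ℕ) : IsCoprime (cfP α n) (cfQ α n : ℤ) := by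
  have hdet := cfQ_mul_cfP_sub α n
  have hs : ((-1 : ℤ) ^ (n + 1)) * (-1) ^ (n + 1) = 1 := by rw [← mul_pow]; simp
  exact ⟨(-1) ^ (n + 1) * cfQ α (n + 1), -((-1) ^ (n + 1) * cfP α (n + 1)), by
    linear_combination (-1) ^ (n + 1) * hdet + hs⟩

theorem cfQ_mul_abs_le {α : ℝ} (hα : Irrational α) (n : ℕ) :
    cfQ α n * |cfQ α n * α - cfP α n| ≤ 1 := by
  refine le_trans ?_ (cfQ_succ_mul_abs_le hα n)
  gcongr
  exact cfQ_le_succ hα n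

theorem cfQ_mul_distNearestInt_le {α : ℝ} (hα : Irrational α) (n : ℕ) :
    cfQ α n * distNearestInt (cfQ α (n - 1) * α) ≤ 1 := by
  have h : cfQ α n * |cfQ α (n - 1) * α - cfP α (n - 1)| ≤ 1 := by
    cases n with
    | zero => exact cfQ_mul_abs_le hα 0
    | succ n => exact cfQ_succ_mul_abs_le hα n
  refine le_trans ?_ h
  gcongr
  exact distNearestInt_le _ _

theorem sum_range_inv_succ_sq_le (q : ℕ) :
    ∑ k ∈ Finset.range q, 1 / ((k : ℝ) + 1) ^ 2 ≤ 2 - 1 / (q : ℝ) := by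
  induction q with
  | zero => simp
  | succ q ih =>
    rw [Finset.sum_range_succ]
    rcases Nat.eq_zero_or_pos q with rfl | hq
    · norm_num
    · have hq' : (0 : ℝ) < q := by exact_mod_cast hq
      have : 1 / ((q : ℝ) + 1) ^ 2 ≤ 1 / q - 1 / (q + 1) := by
        rw [div_sub_div _ _ hq'.ne' (by positivity), div_le_div_iff₀ (by positivity)
          (by positivity)]
        nlinarith
      push_cast
      linarith

/-- A summable weight dominating the normalised contributions of a well-distributed point set. -/
def spacingWeight (q k : ℕ) : ℝ := 9 * (1 / ((k : ℝ) + 1) ^ 2) + if k + 1 = q then 1 else 0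

theorem spacingWeight_nonneg (q k : ℕ) : 0 ≤ spacingWeight q k := by
  unfold spacingWeight
  split_ifs <;> positivity

theorem sum_spacingWeight_le (q : ℕ) : ∑ k ∈ Finset.range q, spacingWeight q k ≤ 19 := by
  have h1 : ∑ k ∈ Finset.range q, (if k + 1 = q then (1 : ℝ) else 0) ≤ 1 := by
    cases q with
    | zero => simp
    | succ q => simp
  have h2 := sum_range_inv_succ_sq_le q
  have h3 : (0 : ℝ) ≤ 1 / q := by positivity
  unfold spacingWeight
  rw [Finset.sum_add_distrib, ← Finset.mul_sum]
  linarith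

/-- The points `z j`, `j < q`, are close to `ρ j / q` for a permutation `ρ` of `{0, …, q - 1}`
(except possibly at the two ends), and all but the point `z j₀` are at least `δ`, where
`δ ≤ 1 / q`. -/
structure WellDistributed (q : ℕ) (δ : ℝ) (z : ℕ → ℝ) (ρ : ℕ → ℕ) (j₀ : ℕ) : Prop where
  pos : 0 < δ
  mul_le : q * δ ≤ 1
  mapsTo : ∀ j < q, ρ j < q
  inj : ∀ i < q, ∀ j < q, ρ i = ρ j → i = j
  close : ∀ j < q, ρ j ≠ 0 → ρ j + 1 ≠ q → (ρ j : ℝ) - 1 ≤ q * z j ∧ q * z j ≤ ρ j + 2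
  mem : j₀ < q
  le : ∀ j < q, j ≠ j₀ → δ ≤ z j

namespace WellDistributed

variable {q : ℕ} {δ : ℝ} {z : ℕ → ℝ} {ρ : ℕ → ℕ} {j₀ : ℕ}

theorem sum_comp (h : WellDistributed q δ z ρ j₀) (f : ℕ → ℝ) :
    ∑ j ∈ Finset.range q, f (ρ j) = ∑ k ∈ Finset.range q, f k := by
  have hm : Set.MapsTo ρ (Finset.range q : Set ℕ) (Finset.range q : Set ℕ) := fun j hj => by
    simpa using h.mapsTo j (by simpa using hj)
  have hi : Set.InjOn ρ (Finset.range q : Set ℕ) := fun i hi j hj e =>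
    h.inj i (by simpa using hi) j (by simpa using hj) e
  exact Finset.sum_bij (fun j _ => ρ j) (fun j hj => hm hj) (fun i a j b e => hi a b e)
    (fun k hk => by
      obtain ⟨j, hj, e⟩ := Finset.surjOn_of_injOn_of_card_le ρ hm hi le_rfl hk
      exact ⟨j, hj, e⟩) (fun _ _ => rfl)

theorem sum_erase_weight_le (h : WellDistributed q δ z ρ j₀) :
    ∑ j ∈ (Finset.range q).erase j₀, spacingWeight q (ρ j) ≤ 19 := by
  refine (Finset.sum_le_sum_of_subset_of_nonneg (Finset.erase_subset _ _)
    fun _ _ _ => spacingWeight_nonneg _ _).trans ?_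
  rw [h.sum_comp]
  exact sum_spacingWeight_le q

theorem div_le (h : WellDistributed q δ z ρ j₀) {j : ℕ} (hj : j < q) (hj₀ : j ≠ j₀) :
    δ / z j ≤ 1 :=
  div_le_one_of_le₀ (h.le j hj hj₀) (h.pos.le.trans (h.le j hj hj₀))

theorem div_le_of_two_le (h : WellDistributed q δ z ρ j₀) {j : ℕ} (hj : j < q) (hj₀ : j ≠ j₀)
    (h2 : 2 ≤ ρ j) (hq : ρ j + 1 ≠ q) : δ / z j ≤ 3 / (ρ j + 1) := by
  have hz : 0 < z j := h.pos.trans_le (h.le j hj hj₀)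
  have hq0 : (0 : ℝ) < q := by exact_mod_cast (Nat.zero_le j).trans_lt hj
  have h2' : (2 : ℝ) ≤ ρ j := by exact_mod_cast h2
  have hc := (h.close j hj (by omega) hq).1
  have hm := h.mul_le
  rw [div_le_div_iff₀ hz (by positivity)]
  have : δ * (q * z j) ≤ z j := by nlinarith
  nlinarith [h.pos]

theorem div_sq_le_weight (h : WellDistributed q δ z ρ j₀) {j : ℕ} (hj : j < q) (hj₀ : j ≠ j₀) :
    (δ / z j) ^ 2 ≤ spacingWeight q (ρ j) := by
  have hz : 0 < z j := h.pos.trans_le (h.le j hj hj₀)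
  have h0 : 0 ≤ δ / z j := div_nonneg h.pos.le hz.le
  unfold spacingWeight
  by_cases hq : ρ j + 1 = q
  · rw [if_pos hq]
    have : (δ / z j) ^ 2 ≤ 1 := pow_le_one₀ h0 (h.div_le hj hj₀)
    have : (0 : ℝ) ≤ 9 * (1 / ((ρ j : ℝ) + 1) ^ 2) := by positivity
    linarith
  · rw [if_neg hq, add_zero]
    have key : δ / z j ≤ 3 / (ρ j + 1) := by
      by_cases h2 : 2 ≤ ρ j
      · exact h.div_le_of_two_le hj hj₀ h2 hq
      · refine (h.div_le hj hj₀).trans ?_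
        have : (ρ j : ℝ) ≤ 1 := by exact_mod_cast (by omega : ρ j ≤ 1)
        rw [le_div_iff₀ (by positivity)]
        linarith
    calc (δ / z j) ^ 2 ≤ (3 / (ρ j + 1)) ^ 2 := pow_le_pow_left₀ h0 key 2
      _ = _ := by rw [div_pow]; ring

theorem sum_pow_le (h : WellDistributed q δ z ρ j₀) {r : ℕ} (hr : 2 ≤ r) :
    ∑ j ∈ (Finset.range q).erase j₀, (1 / z j) ^ r ≤ 19 * δ⁻¹ ^ r := by
  have hδ := h.pos
  have key : ∀ j ∈ (Finset.range q).erase j₀,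
      (1 / z j) ^ r ≤ spacingWeight q (ρ j) * δ⁻¹ ^ r := by
    intro j hj
    obtain ⟨hj₀, hj⟩ := Finset.mem_erase.1 hj
    rw [Finset.mem_range] at hj
    have hz : 0 < z j := hδ.trans_le (h.le j hj hj₀)
    have e : (1 / z j) ^ r = (δ / z j) ^ r * δ⁻¹ ^ r := by
      rw [← mul_pow]
      congr 1
      field_simp
    rw [e]
    gcongr
    exact (pow_le_pow_of_le_one (div_nonneg hδ.le hz.le) (h.div_le hj hj₀) hr).trans
      (h.div_sq_le_weight hj hj₀)
  refine (Finset.sum_le_sum key).trans ?_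
  rw [← Finset.sum_mul]
  gcongr
  exact h.sum_erase_weight_le

theorem abs_inv_sub_le (h : WellDistributed q δ z ρ j₀) {j : ℕ} (hj : j < q) (hj₀ : j ≠ j₀) :
    |1 / z j - q / (ρ j + 1)| ≤ spacingWeight q (ρ j) * δ⁻¹ := by
  have hδ := h.pos
  have hz : 0 < z j := hδ.trans_le (h.le j hj hj₀)
  have hqδ : (q : ℝ) ≤ δ⁻¹ := by
    rw [le_inv_comm₀ (by exact_mod_cast (Nat.zero_le j).trans_lt hj) hδ,
      ← one_div, le_div_iff₀ (by exact_mod_cast (Nat.zero_le j).trans_lt hj), mul_comm]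
    exact h.mul_le
  by_cases hgood : 2 ≤ ρ j ∧ ρ j + 1 ≠ q
  · obtain ⟨h2, hq⟩ := hgood
    obtain ⟨c1, c2⟩ := h.close j hj (by omega) hq
    have hd := h.div_le_of_two_le hj hj₀ h2 hq
    have e : 1 / z j - q / (ρ j + 1)
        = ((ρ j + 1) - q * z j) * (δ / z j * (1 / (ρ j + 1)) * δ⁻¹) := by
      field_simp
    have hb : |((ρ j : ℝ) + 1) - q * z j| ≤ 2 := by
      rw [abs_le]
      constructor <;> linarith
    rw [e, abs_mul, abs_of_nonneg (a := δ / z j * (1 / (ρ j + 1)) * δ⁻¹) (by positivity)]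
    calc |((ρ j : ℝ) + 1) - q * z j| * (δ / z j * (1 / (ρ j + 1)) * δ⁻¹)
        ≤ 2 * (3 / (ρ j + 1) * (1 / (ρ j + 1)) * δ⁻¹) := by gcongr
      _ = 6 * (1 / ((ρ j : ℝ) + 1) ^ 2) * δ⁻¹ := by field_simp; ring
      _ ≤ spacingWeight q (ρ j) * δ⁻¹ := by
        unfold spacingWeight
        rw [if_neg hq, add_zero]
        gcongr
        norm_num
  · have hw : 1 ≤ spacingWeight q (ρ j) := by
      unfold spacingWeight
      by_cases hq : ρ j + 1 = q
      · rw [if_pos hq]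
        have : (0 : ℝ) ≤ 9 * (1 / ((ρ j : ℝ) + 1) ^ 2) := by positivity
        linarith
      · rw [if_neg hq]
        have : (ρ j : ℝ) ≤ 1 := by exact_mod_cast (by omega : ρ j ≤ 1)
        have h0 : (0 : ℝ) ≤ ρ j := by positivity
        rw [add_zero, mul_one_div, le_div_iff₀ (by positivity)]
        nlinarith
    have h1 : 1 / z j ≤ δ⁻¹ := by
      rw [← one_div]
      exact one_div_le_one_div_of_le hδ (h.le j hj hj₀)
    have h2 : (q : ℝ) / (ρ j + 1) ≤ δ⁻¹ :=
      (div_le_self (by positivity) (by linarith [(Nat.cast_nonneg (ρ j) : (0 : ℝ) ≤ ρ j)])).trans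
        hqδ
    have h3 : 0 ≤ 1 / z j := by positivity
    have h4 : 0 ≤ (q : ℝ) / (ρ j + 1) := by positivity
    have h5 : 1 * δ⁻¹ ≤ spacingWeight q (ρ j) * δ⁻¹ := by gcongr
    rw [abs_le]
    constructor <;> linarith

/-- The sum of reciprocals is comparable to a harmonic sum depending only on `q`. -/
theorem abs_sum_inv_sub_le (h : WellDistributed q δ z ρ j₀) :
    |∑ j ∈ (Finset.range q).erase j₀, 1 / z j - ∑ k ∈ Finset.range q, (q : ℝ) / (k + 1)|
      ≤ 20 * δ⁻¹ := by
  have hδ := h.pos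
  rw [← h.sum_comp fun k => (q : ℝ) / (k + 1),
    ← Finset.sum_erase_add _ _ (Finset.mem_range.2 h.mem), ← sub_sub, ← Finset.sum_sub_distrib]
  have h1 : |∑ j ∈ (Finset.range q).erase j₀, (1 / z j - (q : ℝ) / (ρ j + 1))| ≤ 19 * δ⁻¹ := by
    refine (Finset.abs_sum_le_sum_abs _ _).trans ((Finset.sum_le_sum fun j hj => ?_).trans
      (b := ∑ j ∈ (Finset.range q).erase j₀, spacingWeight q (ρ j) * δ⁻¹) ?_)
    · obtain ⟨hj₀, hj⟩ := Finset.mem_erase.1 hj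
      exact h.abs_inv_sub_le (Finset.mem_range.1 hj) hj₀
    · rw [← Finset.sum_mul]
      gcongr
      exact h.sum_erase_weight_le
  have h2 : |(q : ℝ) / (ρ j₀ + 1)| ≤ δ⁻¹ := by
    rw [abs_of_nonneg (by positivity)]
    refine (div_le_self (by positivity)
      (by linarith [(Nat.cast_nonneg (ρ j₀) : (0 : ℝ) ≤ ρ j₀)])).trans ?_
    rw [← one_div, le_div_iff₀ hδ]
    exact h.mul_le
  refine (abs_sub _ _).trans ?_
  linarith

end WellDistributed

/-- The rank of `x + j α` on the circle predicted by the rational approximation `p / q`. -/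
def rationalRank (q : ℕ) (p : ℤ) (x : ℝ) (j : ℕ) : ℕ := ((⌊q * x⌋ + j * p) % q).toNat

theorem rationalRank_cast {q : ℕ} (hq : 0 < q) (p : ℤ) (x : ℝ) (j : ℕ) :
    (rationalRank q p x j : ℤ) = (⌊q * x⌋ + j * p) % q :=
  Int.toNat_of_nonneg (Int.emod_nonneg _ (by omega))

theorem rationalRank_lt {q : ℕ} (hq : 0 < q) (p : ℤ) (x : ℝ) (j : ℕ) :
    rationalRank q p x j < q := by
  have h := Int.emod_lt_of_pos (⌊q * x⌋ + j * p) (by omega : (0 : ℤ) < q)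
  rw [← rationalRank_cast hq] at h
  exact_mod_cast h

theorem rationalRank_inj {q : ℕ} {p : ℤ} (hp : IsCoprime p (q : ℤ)) (x : ℝ) {i j : ℕ}
    (hi : i < q) (hj : j < q) (h : rationalRank q p x i = rationalRank q p x j) : i = j := by
  have hq : 0 < q := (Nat.zero_le i).trans_lt hi
  have h' : (⌊q * x⌋ + i * p) % (q : ℤ) = (⌊q * x⌋ + j * p) % (q : ℤ) := by
    rw [← rationalRank_cast hq, ← rationalRank_cast hq, h]
  have hd : (q : ℤ) ∣ (j - i) * p := by
    have := Int.ModEq.dvd h'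
    rwa [show (⌊q * x⌋ + j * p) - (⌊q * x⌋ + i * p) = (j - i) * p by ring] at this
  have hd' : (q : ℤ) ∣ j - i := hp.symm.dvd_of_dvd_mul_right hd
  have := Int.eq_zero_of_abs_lt_dvd hd' (by rw [abs_lt]; constructor <;> omega)
  omega

theorem rationalRank_close {α : ℝ} {q : ℕ} {p : ℤ} (hpq : q * |q * α - p| ≤ 1) (x : ℝ) {j : ℕ}
    (hj : j < q) (h0 : rationalRank q p x j ≠ 0) (h1 : rationalRank q p x j + 1 ≠ q) :
    (rationalRank q p x j : ℝ) - 1 ≤ q * Int.fract (x + j * α) ∧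
      q * Int.fract (x + j * α) ≤ rationalRank q p x j + 2 := by
  have hq : 0 < q := (Nat.zero_le j).trans_lt hj
  have hqR : (0 : ℝ) < q := by exact_mod_cast hq
  have hlt := rationalRank_lt hq p x j
  have hc := rationalRank_cast hq p x j
  generalize rationalRank q p x j = k at *
  have hk1 : (1 : ℝ) ≤ k := by exact_mod_cast Nat.one_le_iff_ne_zero.2 h0
  have hk2 : (k : ℝ) + 2 ≤ q := by exact_mod_cast (by omega : k + 2 ≤ q)
  have hdm := Int.emod_add_mul_ediv (⌊q * x⌋ + j * p) q
  rw [← hc] at hdm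
  generalize (⌊q * x⌋ + j * p) / (q : ℤ) = t at *
  have hdmR : (k : ℝ) + q * t = ⌊q * x⌋ + j * p := by exact_mod_cast hdm
  have hf := Int.floor_add_fract (q * x)
  have hf0 := Int.fract_nonneg (q * x)
  have hf1 := Int.fract_lt_one (q * x)
  have hjR : (j : ℝ) ≤ q := by exact_mod_cast hj.le
  have he : |(j : ℝ) * (q * α - p)| ≤ 1 := by
    rw [abs_mul, Nat.abs_cast]
    exact (by gcongr : (j : ℝ) * |q * α - p| ≤ q * |q * α - p|).trans hpq
  obtain ⟨he1, he2⟩ := abs_le.1 he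
  have key : q * (x + j * α - t) = k + Int.fract (q * x) + j * (q * α - p) := by
    linear_combination -hdmR - hf
  have hfr : Int.fract (x + j * α) = x + j * α - t := by
    rw [Int.fract_eq_iff]
    refine ⟨?_, ?_, t, by ring⟩
    · by_contra! hneg
      nlinarith
    · by_contra! hge
      nlinarith
  rw [hfr, key]
  constructor <;> linarith

/-- Orbit points are separated by any lower bound for `‖j α‖`, `0 < j < q`. -/
theorem le_abs_fract_sub_fract {α δ : ℝ} {q : ℕ}
    (hsep : ∀ j : ℕ, 0 < j → j < q → ∀ k : ℤ, δ ≤ |j * α - k|) (x : ℝ) {i j : ℕ}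
    (hi : i < q) (hj : j < q) (hij : i ≠ j) :
    δ ≤ |Int.fract (x + i * α) - Int.fract (x + j * α)| := by
  wlog h : j < i generalizing i j
  · rw [abs_sub_comm]
    exact this hj hi hij.symm (by omega)
  have := hsep (i - j) (by omega) (by omega) (⌊x + i * α⌋ - ⌊x + j * α⌋)
  rw [Nat.cast_sub h.le] at this
  push_cast at this
  refine this.trans (le_of_eq ?_)
  rw [← Int.self_sub_floor, ← Int.self_sub_floor]
  congr 1
  ring

theorem exists_sInf_image_Iio_eq {q : ℕ} (hq : 0 < q) (f : ℕ → ℝ) :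
    ∃ j < q, sInf (f '' Set.Iio q) = f j ∧ ∀ i < q, f j ≤ f i := by
  obtain ⟨j, hj, hmin⟩ := Finset.exists_min_image (Finset.range q) f ⟨0, by simpa using hq⟩
  have hmin' : ∀ i < q, f j ≤ f i := fun i hi => hmin i (by simpa using hi)
  refine ⟨j, by simpa using hj, IsLeast.csInf_eq ⟨⟨j, by simpa using hj, rfl⟩, ?_⟩, hmin'⟩
  rintro _ ⟨i, hi, rfl⟩
  exact hmin' i hi

theorem abs_neg_one_pow_mul_add_le {A B H D : ℝ} {r : ℕ} (hr : 1 ≤ r)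
    (hA : 0 ≤ A) (hB : 0 ≤ B) (h1 : r = 1 → |A - H| ≤ D ∧ |B - H| ≤ D)
    (h2 : 2 ≤ r → A ≤ D ∧ B ≤ D) : |(-1) ^ r * A + B| ≤ 2 * D := by
  rcases hr.eq_or_lt with h | h
  · obtain ⟨ha, hb⟩ := h1 h.symm
    rw [← h, pow_one]
    rw [abs_le] at *
    constructor <;> linarith
  · obtain ⟨ha, hb⟩ := h2 h
    refine (abs_add_le _ _).trans ?_
    rw [abs_mul, abs_neg_one_pow, one_mul, abs_of_nonneg hA, abs_of_nonneg hB]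
    linarith

/-- For `h(x) = -log x - log(1-x)`, every `r ≥ 1`, every `n`, and every
`x` whose `q_n`-orbit avoids `0`:
`|S_{q_n}(h^{(r)})(x) − (r−1)![(-1)^r (1/x⁻_{n,min})^r + (1/x⁺_{n,min})^r]|
  < 100 (r−1)! ‖q_{n−1}α‖^{−r}`. -/
theorem statement8 (α : ℝ) (hα : Irrational α) :
    ∀ r : ℕ, 1 ≤ r → ∀ n : ℕ, ∀ x : ℝ,
      (∀ j : ℕ, j < cfQ α n → Int.fract (x + j * α) ≠ 0) →
      |birkhoffRot α (symLogDeriv r) (cfQ α n) x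
          - (Nat.factorial (r - 1) : ℝ) *
            ((-1) ^ r * (1 / orbMinus α x (cfQ α n)) ^ r
              + (1 / orbPlus α x (cfQ α n)) ^ r)|
        < 100 * (Nat.factorial (r - 1) : ℝ)
            * ((distNearestInt ((cfQ α (n - 1) : ℝ) * α))⁻¹) ^ r := by
  intro r hr n x _
  have hq : 0 < cfQ α n := (cfQ_pos hα n).1
  have hcop := isCoprime_cfP_cfQ α n
  have hpq := cfQ_mul_abs_le hα n
  have hδq := cfQ_mul_distNearestInt_le hα n
  have hδ : 0 < distNearestInt ((cfQ α (n - 1) : ℝ) * α) :=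
    distNearestInt_pos (hα.natCast_mul (cfQ_pos hα (n - 1)).1.ne')
  have hsep : ∀ j : ℕ, 0 < j → j < cfQ α n → ∀ k : ℤ,
      distNearestInt ((cfQ α (n - 1) : ℝ) * α) ≤ |j * α - k| := by
    cases n with
    | zero =>
      intro j h0 h1
      simp only [cfQ] at h1
      omega
    | succ n => exact distNearestInt_cfQ_le hα n
  generalize distNearestInt ((cfQ α (n - 1) : ℝ) * α) = δ at *
  generalize cfQ α n = q at *
  generalize cfP α n = p at *
  have hy0 : ∀ j < q, 0 ≤ Int.fract (x + j * α) := fun j _ => Int.fract_nonneg _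
  have hy1 : ∀ j : ℕ, 0 < 1 - Int.fract (x + j * α) := fun j => sub_pos.2 (Int.fract_lt_one _)
  obtain ⟨j₀, hj₀, e₀, m₀⟩ := exists_sInf_image_Iio_eq hq fun j : ℕ => Int.fract (x + j * α)
  obtain ⟨j₁, hj₁, e₁, m₁⟩ := exists_sInf_image_Iio_eq hq fun j : ℕ => 1 - Int.fract (x + j * α)
  have W₀ : WellDistributed q δ (fun j => Int.fract (x + j * α)) (rationalRank q p x) j₀ :=
    { pos := hδ
      mul_le := hδq
      mapsTo := fun j _ => rationalRank_lt hq p x j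
      inj := fun i hi j hj => rationalRank_inj hcop x hi hj
      close := fun j hj => rationalRank_close hpq x hj
      mem := hj₀
      le := fun j hj hne => by
        have h := le_abs_fract_sub_fract hsep x hj hj₀ hne
        rw [abs_of_nonneg (sub_nonneg.2 (m₀ j hj))] at h
        linarith [hy0 j₀ hj₀] }
  have W₁ : WellDistributed q δ (fun j => 1 - Int.fract (x + j * α))
      (fun j => q - 1 - rationalRank q p x j) j₁ :=
    { pos := hδ
      mul_le := hδq
      mapsTo := fun j _ => by omega
      inj := fun i hi j hj h => by
        have h1 := rationalRank_lt hq p x i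
        have h2 := rationalRank_lt hq p x j
        exact rationalRank_inj hcop x hi hj (by omega)
      close := fun j hj h0 h1 => by
        have hl := rationalRank_lt hq p x j
        obtain ⟨c1, c2⟩ := rationalRank_close hpq x hj (by omega) (by omega)
        have : ((q - 1 - rationalRank q p x j : ℕ) : ℝ) = q - 1 - rationalRank q p x j := by
          rw [Nat.cast_sub (by omega), Nat.cast_sub (by omega), Nat.cast_one]
        rw [this]
        constructor <;> linarith
      mem := hj₁
      le := fun j hj hne => by
        have h := le_abs_fract_sub_fract hsep x hj hj₁ hne
        have hm := m₁ j hj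
        rw [abs_of_nonpos (by linarith)] at h
        linarith [hy1 j₁] }
  have hmain := abs_neg_one_pow_mul_add_le (D := 20 * δ⁻¹ ^ r) hr
    (A := ∑ j ∈ (Finset.range q).erase j₀, (1 / Int.fract (x + j * α)) ^ r)
    (B := ∑ j ∈ (Finset.range q).erase j₁, (1 / (1 - Int.fract (x + j * α))) ^ r)
    (H := ∑ k ∈ Finset.range q, (q : ℝ) / (k + 1))
    (Finset.sum_nonneg fun j _ => pow_nonneg (one_div_nonneg.2 (Int.fract_nonneg _)) _)
    (Finset.sum_nonneg fun j _ => pow_nonneg (one_div_nonneg.2 (hy1 j).le) _)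
    (fun h => by
      simp only [h, pow_one]
      exact ⟨W₀.abs_sum_inv_sub_le, W₁.abs_sum_inv_sub_le⟩)
    (fun h => by
      have hp : 0 ≤ δ⁻¹ ^ r := by positivity
      have h₀ := W₀.sum_pow_le h
      have h₁ := W₁.sum_pow_le h
      constructor <;> linarith)
  have hsum : birkhoffRot α (symLogDeriv r) q x = (Nat.factorial (r - 1) : ℝ) *
      ((-1) ^ r * ∑ j ∈ Finset.range q, (1 / Int.fract (x + j * α)) ^ r
        + ∑ j ∈ Finset.range q, (1 / (1 - Int.fract (x + j * α))) ^ r) := by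
    unfold birkhoffRot symLogDeriv
    rw [Finset.mul_sum, ← Finset.sum_add_distrib, Finset.mul_sum]
    refine Finset.sum_congr rfl fun j _ => ?_
    rw [one_div_pow, one_div_pow]
    ring
  have hF : (0 : ℝ) < Nat.factorial (r - 1) := by positivity
  rw [hsum, orbMinus, orbPlus, e₀, e₁,
    ← Finset.sum_erase_add _ _ (Finset.mem_range.2 hj₀),
    ← Finset.sum_erase_add _ (fun j : ℕ => (1 / (1 - Int.fract (x + j * α))) ^ r)
      (Finset.mem_range.2 hj₁), ← mul_sub, abs_mul, abs_of_pos hF, mul_comm (100 : ℝ), mul_assoc]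
  refine mul_lt_mul_of_pos_left ?_ hF
  have hp : 0 < δ⁻¹ ^ r := by positivity
  refine lt_of_le_of_lt (le_of_eq_of_le ?_ hmain) (by linarith)
  congr 1
  ring
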